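/- Dynamic programming principle: for every (x,t) ∈ ℝ^n × [0,T] and every δ ≥ 0 with t + δ ≤ T, one has u(x,t) = sup over admissible uncertainties d on [t,t+δ] of max{ u(φ_{x,t}^d(t+δ), t+δ), max_{1≤i≤n_X} max_{s∈[t,t+δ]} g_i(φ_{x,t}^d(s), s) }. -/

import Mathlib

open Set MeasureTheory RealInnerProductSpace Filter Topology

noncomputable section

abbrev EucSp (n : ℕ) : Type := EuclideanSpace ℝ (Fin n)

/-- An admissible uncertainty on `[t, T]`: a measurable map taking values in `D` there. -/
def Admissible {m : ℕ} (D : Set (EucSp m)) (t T : ℝ) (d : ℝ → EucSp m) : Prop :=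
  Measurable d ∧ ∀ s ∈ Set.Icc t T, d s ∈ D

/-- `y` solves `ẏ(s) = F (y s) (d s)` on `[t, T]` with `y t = x` (integral form,
equivalent to absolute continuity together with the a.e. differential equation). -/
def IsTraj {n m : ℕ} (F : EucSp n → EucSp m → EucSp n) (d : ℝ → EucSp m)
    (t T : ℝ) (x : EucSp n) (y : ℝ → EucSp n) : Prop :=
  y t = x ∧ ∀ s ∈ Set.Icc t T, y s = x + ∫ r in t..s, F (y r) (d r)

/-- The payoff of a trajectory `y` on `[t, T]`:
`max { max_j l_j (y T), max_i sup_{s ∈ [t,T]} g_i (y s, s) }`. -/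
def payoff {n nX nTR : ℕ} (g : Fin nX → EucSp n → ℝ → ℝ) (l : Fin nTR → EucSp n → ℝ)
    (t T : ℝ) (y : ℝ → EucSp n) : ℝ :=
  max (⨆ j, l j (y T)) (⨆ i, sSup ((fun s => g i (y s) s) '' Set.Icc t T))

/-- The defining property of the value function `u`: for `(x, t) ∈ ℝⁿ × [0, T]`,
`u (x, t)` is the supremum of the payoffs over all admissible uncertainties on `[t, T]`
(the trajectory being the unique solution of the ODE driven by the uncertainty). -/
def IsValueFun {n m nX nTR : ℕ} (F : EucSp n → EucSp m → EucSp n) (D : Set (EucSp m))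
    (g : Fin nX → EucSp n → ℝ → ℝ) (l : Fin nTR → EucSp n → ℝ) (T : ℝ)
    (u : EucSp n → ℝ → ℝ) : Prop :=
  ∀ x : EucSp n, ∀ t ∈ Set.Icc (0:ℝ) T,
    u x t = sSup {r | ∃ d y, Admissible D t T d ∧ IsTraj F d t T x y ∧
      r = payoff g l t T y}

/-- The Hamiltonian `H(x, p) = max_{d ∈ D} ⟪p, F x d⟫`. -/
def Ham {n m : ℕ} (F : EucSp n → EucSp m → EucSp n) (D : Set (EucSp m))
    (x p : EucSp n) : ℝ :=
  sSup ((fun d => ⟪p, F x d⟫) '' D)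

/-- Viscosity super-solution of `max{∂ₜ w + H(x, ∇ₓ w), maxᵢ gᵢ(x,t) - w} = 0` on
`ℝⁿ × [0, T]`: a lower semicontinuous function such that for every smooth test function
`ψ` such that `w - ψ` attains a local minimum at `(x₀, t₀) ∈ ℝⁿ × [0, T]`, one has
`max{∂ₜ ψ(x₀,t₀) + H(x₀, ∇ₓ ψ(x₀,t₀)), maxᵢ gᵢ(x₀,t₀) - w(x₀,t₀)} ≤ 0`. -/
def ViscSuper {n m nX : ℕ} (F : EucSp n → EucSp m → EucSp n) (D : Set (EucSp m))
    (g : Fin nX → EucSp n → ℝ → ℝ) (T : ℝ) (w : EucSp n → ℝ → ℝ) : Prop :=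
  LowerSemicontinuousOn (fun p : EucSp n × ℝ => w p.1 p.2) (Set.univ ×ˢ Set.Icc 0 T) ∧
  ∀ ψ : EucSp n → ℝ → ℝ, ContDiff ℝ (⊤ : ℕ∞) (fun p : EucSp n × ℝ => ψ p.1 p.2) →
    ∀ x₀ : EucSp n, ∀ t₀ ∈ Set.Icc (0:ℝ) T,
      IsLocalMinOn (fun p : EucSp n × ℝ => w p.1 p.2 - ψ p.1 p.2)
        (Set.univ ×ˢ Set.Icc 0 T) (x₀, t₀) →
      max (deriv (ψ x₀) t₀ + Ham F D x₀ (gradient (fun z => ψ z t₀) x₀))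
        ((⨆ i, g i x₀ t₀) - w x₀ t₀) ≤ 0

/-- Viscosity sub-solution of `max{∂ₜ w + H(x, ∇ₓ w), maxᵢ gᵢ(x,t) - w} = 0` on
`ℝⁿ × [0, T]`. -/
def ViscSub {n m nX : ℕ} (F : EucSp n → EucSp m → EucSp n) (D : Set (EucSp m))
    (g : Fin nX → EucSp n → ℝ → ℝ) (T : ℝ) (w : EucSp n → ℝ → ℝ) : Prop :=
  UpperSemicontinuousOn (fun p : EucSp n × ℝ => w p.1 p.2) (Set.univ ×ˢ Set.Icc 0 T) ∧
  ∀ ψ : EucSp n → ℝ → ℝ, ContDiff ℝ (⊤ : ℕ∞) (fun p : EucSp n × ℝ => ψ p.1 p.2) →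
    ∀ x₀ : EucSp n, ∀ t₀ ∈ Set.Icc (0:ℝ) T,
      IsLocalMaxOn (fun p : EucSp n × ℝ => w p.1 p.2 - ψ p.1 p.2)
        (Set.univ ×ˢ Set.Icc 0 T) (x₀, t₀) →
      0 ≤ max (deriv (ψ x₀) t₀ + Ham F D x₀ (gradient (fun z => ψ z t₀) x₀))
        ((⨆ i, g i x₀ t₀) - w x₀ t₀)

/-- The backward reachable set at time `t` (horizon `T`) of the target `{maxⱼ lⱼ ≤ 0}`
under state constraints `{maxᵢ gᵢ(·, s) ≤ 0}`, for the dynamics `f` driven by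
uncertainties in `D`: the set of `x` such that for every admissible uncertainty the
(unique) solution extends to all of `[t, T]`, respects the state constraints there,
and ends up in the target at time `T`. -/
def Reach {n m nX nTR : ℕ} (f : EucSp n → EucSp m → EucSp n) (D : Set (EucSp m))
    (g : Fin nX → EucSp n → ℝ → ℝ) (l : Fin nTR → EucSp n → ℝ)
    (t T : ℝ) : Set (EucSp n) :=
  {x | ∀ d, Admissible D t T d → ∃ y, IsTraj f d t T x y ∧
    (∀ s ∈ Set.Icc t T, ∀ i, g i (y s) s ≤ 0) ∧ ∀ j, l j (y T) ≤ 0}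

section Trajectories

variable {n m : ℕ} {F : EucSp n → EucSp m → EucSp n} {D : Set (EucSp m)}

/-- A solution is continuous on every interval on which its velocity is integrable. -/
lemma IsTraj.continuousOn {d : ℝ → EucSp m} {t T s : ℝ} {x : EucSp n} {y : ℝ → EucSp n}
    (hy : IsTraj F d t T x y) (hs : s ∈ Icc t T)
    (hint : IntervalIntegrable (fun r => F (y r) (d r)) volume t s) :
    ContinuousOn y (Icc t s) := by
  have h := intervalIntegral.continuousOn_primitive_interval' hint left_mem_uIcc
  rw [uIcc_of_le hs.1] at h
  exact (continuousOn_const.add h).congr fun r hr => hy.2 r ⟨hr.1, hr.2.trans hs.2⟩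

/-- Grönwall estimate for solutions. It needs no integrability assumption: where the velocity is
not integrable, the Bochner integral vanishes and the solution equals its initial value. -/
lemma IsTraj.norm_sub_le_gronwallBound {L C : ℝ} (hL : 0 ≤ L) (hC : 0 ≤ C)
    (hFlip : ∀ x y : EucSp n, ∀ d ∈ D, ‖F x d - F y d‖ ≤ L * ‖x - y‖)
    {d : ℝ → EucSp m} {t T : ℝ} {x : EucSp n} {y : ℝ → EucSp n}
    (hFx : ∀ d ∈ D, ‖F x d‖ ≤ C)
    (hd : Admissible D t T d) (hy : IsTraj F d t T x y) {s : ℝ} (hs : s ∈ Icc t T) :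
    ‖y s - x‖ ≤ gronwallBound 0 L C (T - t) := by
  have hmono := gronwallBound_mono (le_refl (0 : ℝ)) hC hL
  by_cases hint : IntervalIntegrable (fun r => F (y r) (d r)) volume t s
  swap
  · rw [hy.2 s hs, intervalIntegral.integral_undef hint, add_zero, sub_self, norm_zero]
    have h0 := hmono (sub_nonneg.2 (hs.1.trans hs.2))
    rwa [gronwallBound_x0] at h0
  have hcont := hy.continuousOn hs hint
  let φ : ℝ → ℝ := fun r => ‖IccExtend hs.1 ((Icc t s).domRestrict y) r - x‖
  have hφc : Continuous φ :=
    ((continuous_IccExtend_iff.2 hcont.domRestrict).sub continuous_const).norm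
  have hφ : ∀ r ∈ Icc t s, φ r = ‖y r - x‖ := fun r hr => by
    simp only [φ, IccExtend_of_mem hs.1 _ hr, domRestrict_apply]
  have hψc : Continuous fun r => C + L * φ r := by fun_prop
  let G : ℝ → ℝ := fun r => ∫ q in t..r, (C + L * φ q)
  have hG : ∀ r, HasDerivAt G (C + L * φ r) r := fun r =>
    intervalIntegral.integral_hasDerivAt_right (hψc.intervalIntegrable _ _)
      hψc.stronglyMeasurable.stronglyMeasurableAtFilter hψc.continuousAt
  have hle : ∀ r ∈ Icc t s, φ r ≤ G r := by
    intro r hr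
    rw [hφ r hr, hy.2 r ⟨hr.1, hr.2.trans hs.2⟩, add_sub_cancel_left]
    refine intervalIntegral.norm_integral_le_of_norm_le hr.1 ?_ (hψc.intervalIntegrable _ _)
    refine Eventually.of_forall fun q hq => ?_
    have hqs : q ∈ Icc t s := ⟨hq.1.le, hq.2.trans hr.2⟩
    have hdq := hd.2 q ⟨hqs.1, hqs.2.trans hs.2⟩
    rw [hφ q hqs]
    calc ‖F (y q) (d q)‖ ≤ ‖F x (d q)‖ + ‖F (y q) (d q) - F x (d q)‖ :=
          norm_le_norm_add_norm_sub' _ _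
      _ ≤ C + L * ‖y q - x‖ := add_le_add (hFx _ hdq) (hFlip _ _ _ hdq)
  have hφ0 : ∀ r, 0 ≤ φ r := fun r => norm_nonneg _
  have hgr := norm_le_gronwallBound_of_norm_deriv_right_le (f := G)
    (f' := fun r => C + L * φ r) (δ := 0) (K := L) (ε := C) (a := t) (b := s)
    (fun r _ => (hG r).continuousAt.continuousWithinAt)
    (fun r _ => (hG r).hasDerivWithinAt) (by simp [G])
    (fun r hr => by
      have h1 := hle r (Ico_subset_Icc_self hr)
      have h2 := hφ0 r
      rw [Real.norm_of_nonneg (by positivity), Real.norm_of_nonneg (h2.trans h1), add_comm]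
      gcongr)
    s (right_mem_Icc.2 hs.1)
  rw [← hφ s (right_mem_Icc.2 hs.1)]
  exact (hle s (right_mem_Icc.2 hs.1)).trans ((le_abs_self _).trans
    (hgr.trans (hmono (sub_le_sub_right hs.2 t))))

/-- All solutions from a given initial value stay in a common ball. -/
lemma exists_norm_sub_le_of_isTraj (hD : IsCompact D)
    (hF : Continuous fun p : EucSp n × EucSp m => F p.1 p.2) {L : ℝ} (hL : 0 ≤ L)
    (hFlip : ∀ x y : EucSp n, ∀ d ∈ D, ‖F x d - F y d‖ ≤ L * ‖x - y‖)
    (t T : ℝ) (x : EucSp n) :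
    ∃ R, ∀ d y, Admissible D t T d → IsTraj F d t T x y → ∀ s ∈ Icc t T, ‖y s - x‖ ≤ R := by
  obtain ⟨C, hC⟩ := hD.exists_bound_of_continuousOn (f := F x)
    (hF.comp (Continuous.prodMk_right x)).continuousOn
  exact ⟨_, fun d y hd hy s hs => hy.norm_sub_le_gronwallBound hL (le_max_right C 0) hFlip
    (fun e he => (hC e he).trans (le_max_left C 0)) hd hs⟩

/-- The velocity of a solution driven by an admissible uncertainty is integrable. -/
lemma IsTraj.integrableOn (hD : IsCompact D)
    (hF : Continuous fun p : EucSp n × EucSp m => F p.1 p.2) {L : ℝ} (hL : 0 ≤ L)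
    (hFlip : ∀ x y : EucSp n, ∀ d ∈ D, ‖F x d - F y d‖ ≤ L * ‖x - y‖)
    {d : ℝ → EucSp m} {t T : ℝ} {x : EucSp n} {y : ℝ → EucSp n}
    (hd : Admissible D t T d) (hy : IsTraj F d t T x y) :
    IntegrableOn (fun r => F (y r) (d r)) (Icc t T) := by
  let A : Set ℝ := {s | s ∈ Icc t T ∧ IntervalIntegrable (fun r => F (y r) (d r)) volume t s}
  have hAdown : ∀ s ∈ A, Icc t s ⊆ A := fun s hs r hr =>
    ⟨⟨hr.1, hr.2.trans hs.1.2⟩, hs.2.mono_set (by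
      rw [uIcc_of_le hr.1, uIcc_of_le hs.1.1]; exact Icc_subset_Icc_right hr.2)⟩
  have hAm : MeasurableSet A := OrdConnected.measurableSet
    ⟨fun a ha b hb r hr => hAdown b hb ⟨ha.1.1.trans hr.1, hr.2⟩⟩
  have hAc : ContinuousOn y A := by
    intro s hs
    by_cases h : ∃ s' ∈ A, s < s'
    · obtain ⟨s', hs', hlt⟩ := h
      refine ((hy.continuousOn hs'.1 hs'.2) s ⟨hs.1.1, hlt.le⟩).mono_of_mem_nhdsWithin ?_
      filter_upwards [self_mem_nhdsWithin, mem_nhdsWithin_of_mem_nhds (Iio_mem_nhds hlt)]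
        with r hr hr'
      exact ⟨hr.1.1, le_of_lt hr'⟩
    · push Not at h
      exact ((hy.continuousOn hs.1 hs.2) s (right_mem_Icc.2 hs.1.1)).mono
        fun r hr => ⟨hr.1.1, h r hr⟩
  have hyB : ∀ s ∈ Icc t T \ A, y s = x := fun s hs => by
    rw [hy.2 s hs.1, intervalIntegral.integral_undef fun h => hs.2 ⟨hs.1, h⟩, add_zero]
  have hym : AEStronglyMeasurable y (volume.restrict (Icc t T)) := by
    have hU : Icc t T = A ∪ (Icc t T \ A) := (union_sdiff_cancel fun s hs => hs.1).symm
    rw [hU, aestronglyMeasurable_union_iff]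
    refine ⟨hAc.aestronglyMeasurable hAm, ?_⟩
    refine (aestronglyMeasurable_const (b := x)).congr ?_
    filter_upwards [ae_restrict_mem (measurableSet_Icc.diff hAm)] with s hs
    exact (hyB s hs).symm
  have hm : AEStronglyMeasurable (fun r => F (y r) (d r)) (volume.restrict (Icc t T)) :=
    hF.comp_aestronglyMeasurable (hym.prodMk hd.1.aestronglyMeasurable)
  obtain ⟨R, hR⟩ := exists_norm_sub_le_of_isTraj hD hF hL hFlip t T x
  obtain ⟨C, hC⟩ := ((isCompact_closedBall x R).prod hD).exists_bound_of_continuousOn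
    hF.continuousOn
  refine Integrable.of_bound hm C ?_
  filter_upwards [ae_restrict_mem measurableSet_Icc] with s hs
  exact hC (y s, d s) ⟨mem_closedBall_iff_norm.2 (hR d y hd hy s hs), hd.2 s hs⟩

lemma IsTraj.intervalIntegrable (hD : IsCompact D)
    (hF : Continuous fun p : EucSp n × EucSp m => F p.1 p.2) {L : ℝ} (hL : 0 ≤ L)
    (hFlip : ∀ x y : EucSp n, ∀ d ∈ D, ‖F x d - F y d‖ ≤ L * ‖x - y‖)
    {d : ℝ → EucSp m} {t T : ℝ} {x : EucSp n} {y : ℝ → EucSp n}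
    (hd : Admissible D t T d) (hy : IsTraj F d t T x y) {a b : ℝ}
    (ha : a ∈ Icc t T) (hb : b ∈ Icc t T) :
    IntervalIntegrable (fun r => F (y r) (d r)) volume a b :=
  ((hy.integrableOn hD hF hL hFlip hd).mono_set
    (ordConnected_Icc.uIcc_subset ha hb)).intervalIntegrable

lemma Admissible.mono {d : ℝ → EucSp m} {t T t' T' : ℝ} (hd : Admissible D t T d)
    (ht : t ≤ t') (hT : T' ≤ T) : Admissible D t' T' d :=
  ⟨hd.1, fun s hs => hd.2 s (Icc_subset_Icc ht hT hs)⟩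

lemma IsTraj.restrict_right {d : ℝ → EucSp m} {t T a : ℝ} {x : EucSp n} {y : ℝ → EucSp n}
    (hy : IsTraj F d t T x y) (ha : a ≤ T) : IsTraj F d t a x y :=
  ⟨hy.1, fun s hs => hy.2 s ⟨hs.1, hs.2.trans ha⟩⟩

/-- The flow property: the tail of a solution is a solution. -/
lemma IsTraj.restrict_left (hD : IsCompact D)
    (hF : Continuous fun p : EucSp n × EucSp m => F p.1 p.2) {L : ℝ} (hL : 0 ≤ L)
    (hFlip : ∀ x y : EucSp n, ∀ d ∈ D, ‖F x d - F y d‖ ≤ L * ‖x - y‖)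
    {d : ℝ → EucSp m} {t T a : ℝ} {x : EucSp n} {y : ℝ → EucSp n}
    (hd : Admissible D t T d) (hy : IsTraj F d t T x y) (ha : a ∈ Icc t T) :
    IsTraj F d a T (y a) y := by
  refine ⟨rfl, fun s hs => ?_⟩
  have hs' : s ∈ Icc t T := ⟨ha.1.trans hs.1, hs.2⟩
  have ht : t ∈ Icc t T := left_mem_Icc.2 (ha.1.trans ha.2)
  rw [hy.2 s hs', hy.2 a ha, add_assoc, intervalIntegral.integral_add_adjacent_intervals
    (hy.intervalIntegrable hD hF hL hFlip hd ht ha)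
    (hy.intervalIntegrable hD hF hL hFlip hd ha hs')]

lemma Admissible.concat {d d' : ℝ → EucSp m} {t a T : ℝ} (hd : Admissible D t a d)
    (hd' : Admissible D a T d') : Admissible D t T (fun s => if s ≤ a then d s else d' s) := by
  refine ⟨Measurable.ite measurableSet_Iic hd.1 hd'.1, fun s hs => ?_⟩
  dsimp only
  split_ifs with h
  · exact hd.2 s ⟨hs.1, h⟩
  · exact hd'.2 s ⟨(not_le.1 h).le, hs.2⟩

/-- Two solutions that meet at time `a` can be concatenated. -/
lemma IsTraj.concat (hD : IsCompact D)
    (hF : Continuous fun p : EucSp n × EucSp m => F p.1 p.2) {L : ℝ} (hL : 0 ≤ L)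
    (hFlip : ∀ x y : EucSp n, ∀ d ∈ D, ‖F x d - F y d‖ ≤ L * ‖x - y‖)
    {d d' : ℝ → EucSp m} {t a T : ℝ} {x : EucSp n} {y y' : ℝ → EucSp n} (hta : t ≤ a)
    (hd : Admissible D t a d) (hy : IsTraj F d t a x y)
    (hd' : Admissible D a T d') (hy' : IsTraj F d' a T (y a) y') :
    IsTraj F (fun s => if s ≤ a then d s else d' s) t T x
      (fun s => if s ≤ a then y s else y' s) := by
  refine ⟨by simp [hta, hy.1], fun s hs => ?_⟩
  have hleft : ∀ b, t ≤ b → b ≤ a → EqOn (fun r => F (y r) (d r)) (fun r =>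
      F (if r ≤ a then y r else y' r) (if r ≤ a then d r else d' r)) (uIoc t b) := by
    intro b htb hb r hr
    rw [uIoc_of_le htb] at hr
    simp [hr.2.trans hb]
  have hright : ∀ b, a ≤ b → EqOn (fun r => F (y' r) (d' r)) (fun r =>
      F (if r ≤ a then y r else y' r) (if r ≤ a then d r else d' r)) (uIoc a b) := by
    intro b hab r hr
    rw [uIoc_of_le hab] at hr
    simp [not_le.2 hr.1]
  by_cases h : s ≤ a
  · simp only [h, if_true]
    rw [hy.2 s ⟨hs.1, h⟩]
    congr 1
    exact intervalIntegral.integral_congr_ae (Eventually.of_forall (hleft s hs.1 h))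
  · have has : a ≤ s := (not_le.1 h).le
    have hmem : a ∈ Icc t a := right_mem_Icc.2 hta
    have hi := hy.intervalIntegrable hD hF hL hFlip hd (left_mem_Icc.2 hta) hmem
    have hi' := hy'.intervalIntegrable hD hF hL hFlip hd'
      (left_mem_Icc.2 (has.trans hs.2)) ⟨has, hs.2⟩
    simp only [h, if_false]
    rw [hy'.2 s ⟨has, hs.2⟩, hy.2 a hmem, add_assoc,
      ← intervalIntegral.integral_add_adjacent_intervals (hi.congr (hleft a hta le_rfl))
        (hi'.congr (hright s has)),
      intervalIntegral.integral_congr_ae (Eventually.of_forall (hleft a hta le_rfl)),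
      intervalIntegral.integral_congr_ae (Eventually.of_forall (hright s has))]

lemma admissible_const {e : EucSp m} (he : e ∈ D) (t T : ℝ) : Admissible D t T fun _ => e :=
  ⟨measurable_const, fun _ _ => he⟩

/-- Existence of solutions for a constant uncertainty over a short time span whose length is
independent of the initial value. -/
lemma exists_isTraj_const_of_short {L : ℝ} (hL : 0 ≤ L)
    (hFlip : ∀ x y : EucSp n, ∀ d ∈ D, ‖F x d - F y d‖ ≤ L * ‖x - y‖)
    {e : EucSp m} (he : e ∈ D) (x : EucSp n) {t T : ℝ} (htT : t ≤ T)
    (hshort : (L + 1) * (T - t) ≤ 1 / 2) :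
    ∃ y, IsTraj F (fun _ => e) t T x y := by
  let K : NNReal := ⟨L, hL⟩
  let C : NNReal := ‖F x e‖₊
  have hlip : LipschitzWith K fun z => F z e :=
    LipschitzWith.of_dist_le_mul fun z w => by
      rw [dist_eq_norm, dist_eq_norm]; exact hFlip z w e he
  have hPL : IsPicardLindelof (fun _ z => F z e) (⟨t, left_mem_Icc.2 htT⟩ : Icc t T) x
      C 0 ((K + 1) * C) K := by
    refine IsPicardLindelof.of_time_independent (fun z hz => ?_) hlip.lipschitzOnWith ?_
    · have h1 := norm_le_norm_add_norm_sub' (F z e) (F x e)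
      have h2 := hFlip z x e he
      have h3 : ‖z - x‖ ≤ ‖F x e‖ := mem_closedBall_iff_norm.1 hz
      have h4 := mul_le_mul_of_nonneg_left h3 hL
      change ‖F z e‖ ≤ (L + 1) * ‖F x e‖
      linarith
    · rw [sub_self, max_eq_left (sub_nonneg.2 htT)]
      change (L + 1) * ‖F x e‖ * (T - t) ≤ ‖F x e‖ - 0
      nlinarith [norm_nonneg (F x e)]
  obtain ⟨y, hy0, hy⟩ := hPL.exists_eq_forall_mem_Icc_eq_picard
    (Metric.mem_closedBall_self (by simp))
  exact ⟨y, hy0, hy⟩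

/-- Global existence of solutions for a constant uncertainty. -/
lemma exists_isTraj_const (hD : IsCompact D)
    (hF : Continuous fun p : EucSp n × EucSp m => F p.1 p.2) {L : ℝ} (hL : 0 ≤ L)
    (hFlip : ∀ x y : EucSp n, ∀ d ∈ D, ‖F x d - F y d‖ ≤ L * ‖x - y‖)
    {e : EucSp m} (he : e ∈ D) (x : EucSp n) (t T : ℝ) :
    ∃ y, IsTraj F (fun _ => e) t T x y := by
  let h : ℝ := 1 / (2 * (L + 1))
  have hh : 0 < h := by positivity
  have hLh : (L + 1) * h = 1 / 2 := by simp only [h]; field_simp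
  have hsteps : ∀ k : ℕ, ∃ y, IsTraj F (fun _ => e) t (t + k * h) x y := by
    intro k
    induction k with
    | zero => exact exists_isTraj_const_of_short hL hFlip he x (by simp) (by simp)
    | succ k ih =>
      obtain ⟨y, hy⟩ := ih
      obtain ⟨y', hy'⟩ := exists_isTraj_const_of_short hL hFlip he (y (t + k * h))
        (t := t + k * h) (T := t + (k + 1 : ℕ) * h) (by push_cast; nlinarith)
        (by push_cast; nlinarith)
      have hc := hy.concat hD hF hL hFlip (le_add_of_nonneg_right (by positivity))
        (admissible_const he _ _) (admissible_const he _ _) hy'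
      simp only [ite_self] at hc
      exact ⟨_, hc⟩
  obtain ⟨k, hk⟩ := exists_nat_ge ((T - t) / h)
  obtain ⟨y, hy⟩ := hsteps k
  exact ⟨y, hy.restrict_right (by rw [div_le_iff₀ hh] at hk; linarith)⟩

end Trajectories

section Payoff

variable {n nX nTR : ℕ} {g : Fin nX → EucSp n → ℝ → ℝ} {l : Fin nTR → EucSp n → ℝ}

lemma payoff_congr {t T : ℝ} {y z : ℝ → EucSp n} (htT : t ≤ T) (h : EqOn y z (Icc t T)) :
    payoff g l t T y = payoff g l t T z := by
  have himg : ∀ i, (fun s => g i (y s) s) '' Icc t T = (fun s => g i (z s) s) '' Icc t T :=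
    fun i => image_congr fun s hs => by rw [h hs]
  simp only [payoff, himg, h (right_mem_Icc.2 htT)]

/-- The payoff splits at an intermediate time. -/
lemma payoff_eq_max {t a T : ℝ} {y : ℝ → EucSp n} (ha : a ∈ Icc t T)
    (hb : ∀ i, BddAbove ((fun s => g i (y s) s) '' Icc t T)) :
    payoff g l t T y =
      max (payoff g l a T y) (⨆ i, sSup ((fun s => g i (y s) s) '' Icc t a)) := by
  have hsplit : ∀ i, sSup ((fun s => g i (y s) s) '' Icc t T) =
      sSup ((fun s => g i (y s) s) '' Icc a T) ⊔ sSup ((fun s => g i (y s) s) '' Icc t a) := by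
    intro i
    rw [← Icc_union_Icc_eq_Icc ha.1 ha.2, image_union, union_comm]
    exact csSup_union ((hb i).mono (image_mono (Icc_subset_Icc_left ha.1)))
      ((nonempty_Icc.2 ha.2).image _)
      ((hb i).mono (image_mono (Icc_subset_Icc_right ha.2))) ((nonempty_Icc.2 ha.1).image _)
  simp only [payoff, hsplit]
  rw [ciSup_sup_eq (finite_range _).bddAbove (finite_range _).bddAbove, ← sup_assoc]

/-- Along bounded curves the state constraints are bounded above, uniformly in the curve. -/
lemma exists_state_payoff_le (hg : ∀ i, Continuous fun p : EucSp n × ℝ => g i p.1 p.2)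
    (t T : ℝ) (x : EucSp n) (R : ℝ) :
    ∃ M, ∀ i, ∀ y : ℝ → EucSp n, (∀ s ∈ Icc t T, ‖y s - x‖ ≤ R) →
      ∀ s ∈ Icc t T, g i (y s) s ≤ M := by
  have h : ∀ i, ∃ M, ∀ p ∈ Metric.closedBall x R ×ˢ Icc t T, ‖g i p.1 p.2‖ ≤ M := fun i =>
    ((isCompact_closedBall x R).prod isCompact_Icc).exists_bound_of_continuousOn
      (hg i).continuousOn
  choose M hM using h
  refine ⟨⨆ i, M i, fun i y hy s hs => ?_⟩
  exact (le_abs_self _).trans ((hM i (y s, s) ⟨mem_closedBall_iff_norm.2 (hy s hs), hs⟩).trans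
    (le_ciSup (finite_range M).bddAbove i))

/-- Payoffs of bounded curves are bounded above, uniformly in the curve. -/
lemma exists_payoff_le (hnX : 0 < nX) (hnTR : 0 < nTR)
    (hg : ∀ i, Continuous fun p : EucSp n × ℝ => g i p.1 p.2) (hl : ∀ j, Continuous (l j))
    {t T : ℝ} (htT : t ≤ T) (x : EucSp n) (R : ℝ) :
    ∃ M, ∀ y : ℝ → EucSp n, (∀ s ∈ Icc t T, ‖y s - x‖ ≤ R) → payoff g l t T y ≤ M := by
  have : Nonempty (Fin nX) := ⟨⟨0, hnX⟩⟩
  have : Nonempty (Fin nTR) := ⟨⟨0, hnTR⟩⟩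
  obtain ⟨M, hM⟩ := exists_state_payoff_le hg t T x R
  obtain ⟨N, hN⟩ := exists_state_payoff_le (g := fun j z _ => l j z)
    (fun j => (hl j).comp continuous_fst) t T x R
  refine ⟨max N M, fun y hy => max_le_max ?_ ?_⟩
  · exact ciSup_le fun j => hN j y hy T (right_mem_Icc.2 htT)
  · refine ciSup_le fun i => csSup_le ((nonempty_Icc.2 htT).image _) ?_
    rintro _ ⟨s, hs, rfl⟩
    exact hM i y hy s hs

end Payoff

/-- The dynamic programming principle for the value function. -/
theorem stmt3
    {n m nX nTR : ℕ} (hn : 0 < n) (hm : 0 < m) (hnX : 0 < nX) (hnTR : 0 < nTR)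
    (T : ℝ) (hT : 0 < T)
    (D : Set (EucSp m)) (hDne : D.Nonempty) (hDcomp : IsCompact D)
    (F : EucSp n → EucSp m → EucSp n)
    (hFcont : Continuous fun p : EucSp n × EucSp m => F p.1 p.2)
    (LF : ℝ) (hLF : 0 ≤ LF)
    (hFlip : ∀ x y : EucSp n, ∀ d ∈ D, ‖F x d - F y d‖ ≤ LF * ‖x - y‖)
    (g : Fin nX → EucSp n → ℝ → ℝ) (l : Fin nTR → EucSp n → ℝ)
    (hg : ∀ i, LocallyLipschitz fun p : EucSp n × ℝ => g i p.1 p.2)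
    (hl : ∀ j, LocallyLipschitz (l j))
    (u : EucSp n → ℝ → ℝ) (hu : IsValueFun F D g l T u)
 :
    ∀ x : EucSp n, ∀ t ∈ Set.Icc (0:ℝ) T, ∀ δ : ℝ, 0 ≤ δ → t + δ ≤ T →
      u x t = sSup {r | ∃ d y, Admissible D t (t + δ) d ∧ IsTraj F d t (t + δ) x y ∧
        r = max (u (y (t + δ)) (t + δ))
          (⨆ i, sSup ((fun s => g i (y s) s) '' Set.Icc t (t + δ)))} := by
  intro x t ht δ hδ htδ
  have hgc := fun i => (hg i).continuous
  have hlc := fun j => (hl j).continuous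
  have hbdd : ∀ z : EucSp n, ∀ τ ≤ T, BddAbove {r | ∃ d y, Admissible D τ T d ∧
      IsTraj F d τ T z y ∧ r = payoff g l τ T y} := by
    intro z τ hτ
    obtain ⟨R, hR⟩ := exists_norm_sub_le_of_isTraj hDcomp hFcont hLF hFlip τ T z
    obtain ⟨M, hM⟩ := exists_payoff_le hnX hnTR hgc hlc hτ z R
    refine ⟨M, ?_⟩
    rintro _ ⟨d, y, hd, hy, rfl⟩
    exact hM y (hR d y hd hy)
  obtain ⟨e, he⟩ := hDne
  have hne : ∀ z : EucSp n, ∀ τ, {r | ∃ d y, Admissible D τ T d ∧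
      IsTraj F d τ T z y ∧ r = payoff g l τ T y}.Nonempty := by
    intro z τ
    obtain ⟨y, hy⟩ := exists_isTraj_const hDcomp hFcont hLF hFlip he z τ T
    exact ⟨_, _, y, admissible_const he τ T, hy, rfl⟩
  have hmem : t + δ ∈ Icc t T := ⟨by linarith, htδ⟩
  have hmem0 : t + δ ∈ Icc 0 T := ⟨ht.1.trans hmem.1, htδ⟩
  have hsplit : ∀ d y, Admissible D t T d → IsTraj F d t T x y → payoff g l t T y =
      max (payoff g l (t + δ) T y)
        (⨆ i, sSup ((fun s => g i (y s) s) '' Icc t (t + δ))) := by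
    intro d y hd hy
    obtain ⟨R, hR⟩ := exists_norm_sub_le_of_isTraj hDcomp hFcont hLF hFlip t T x
    obtain ⟨M, hM⟩ := exists_state_payoff_le hgc t T x R
    refine payoff_eq_max hmem fun i => ⟨M, ?_⟩
    rintro _ ⟨s, hs, rfl⟩
    exact hM i y (hR d y hd hy) s hs
  have hub : ∀ r ∈ {r | ∃ d y, Admissible D t (t + δ) d ∧ IsTraj F d t (t + δ) x y ∧
      r = max (u (y (t + δ)) (t + δ))
        (⨆ i, sSup ((fun s => g i (y s) s) '' Icc t (t + δ)))}, r ≤ u x t := by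
    rintro _ ⟨d, y, hd, hy, rfl⟩
    have key : ∀ d' y', Admissible D (t + δ) T d' → IsTraj F d' (t + δ) T (y (t + δ)) y' →
        max (payoff g l (t + δ) T y')
          (⨆ i, sSup ((fun s => g i (y s) s) '' Icc t (t + δ))) ≤ u x t := by
      intro d' y' hd' hy'
      have hdc := hd.concat hd'
      have hyc := hy.concat hDcomp hFcont hLF hFlip hmem.1 hd hd' hy'
      rw [hu x t ht]
      refine le_csSup (hbdd x t ht.2) ⟨_, _, hdc, hyc, ?_⟩
      rw [hsplit _ _ hdc hyc]
      congr 1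
      · refine payoff_congr htδ fun s hs => ?_
        split_ifs with h
        · rw [le_antisymm h hs.1, hy'.1]
        · rfl
      · refine iSup_congr fun i => congrArg sSup (image_congr fun s hs => ?_)
        simp only [hs.2, if_true]
    refine max_le ?_ ?_
    · rw [hu _ _ hmem0]
      refine csSup_le (hne _ _) ?_
      rintro _ ⟨d', y', hd', hy', rfl⟩
      exact (le_max_left _ _).trans (key d' y' hd' hy')
    · obtain ⟨_, d', y', hd', hy', -⟩ := hne (y (t + δ)) (t + δ)
      exact (le_max_right _ _).trans (key d' y' hd' hy')
  refine le_antisymm ?_ ?_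
  · rw [hu x t ht]
    refine csSup_le (hne x t) ?_
    rintro _ ⟨d, y, hd, hy, rfl⟩
    refine le_trans ?_ (le_csSup ⟨_, hub⟩
      ⟨d, y, hd.mono le_rfl htδ, hy.restrict_right htδ, rfl⟩)
    rw [hsplit d y hd hy, hu _ _ hmem0]
    refine max_le_max (le_csSup (hbdd _ _ htδ) ?_) le_rfl
    exact ⟨d, y, hd.mono hmem.1 le_rfl,
      hy.restrict_left hDcomp hFcont hLF hFlip hd hmem, rfl⟩
  · obtain ⟨y, hy⟩ := exists_isTraj_const hDcomp hFcont hLF hFlip he x t (t + δ)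
    exact csSup_le ⟨_, _, y, admissible_const he _ _, hy, rfl⟩ hub

end
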